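/- Let a : ℕ → ℂ be a sequence with Σ_{k≥1} ((k−2)(k−1)k)² |a_k|² < ∞ and Σ_{k≥1} |a_k|² < ∞. Write h = (Σ_{k≥1} k⁶ |a_k|²)^{1/2}, g = (Σ_{k≥1} ((k−2)(k−1)k)² |a_k|²)^{1/2} and f = (Σ_{k≥1} |a_k|²)^{1/2}. Then (Σ_{k≥1} (k(k−1))² |a_k|²)^{1/2} ≤ h^{2/3} f^{1/3} and (Σ_{k≥1} (k(k−1))² |a_k|²)^{1/2} ≤ 5^{2/3} g^{2/3} f^{1/3} + 65^{1/3} f. -/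

import Mathlib

/-- Hölder's inequality with exponents `3 / 2` and `3`, for a sequence `w` dominated by
the weighted geometric mean of `u` and `v`. -/
theorem summable_and_tsum_le_of_cube_le {u v w : ℕ → ℝ} (hu : Summable u) (hv : Summable v)
    (hu0 : ∀ k, 0 ≤ u k) (hv0 : ∀ k, 0 ≤ v k) (hw0 : ∀ k, 0 ≤ w k)
    (hw : ∀ k, w k ^ 3 ≤ u k ^ 2 * v k) :
    Summable w ∧ ∑' k, w k ≤ (∑' k, u k) ^ ((2 : ℝ) / 3) * (∑' k, v k) ^ ((1 : ℝ) / 3) := by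
  have hpq : Real.HolderConjugate (3 / 2) 3 :=
    Real.holderConjugate_iff.mpr ⟨by norm_num, by norm_num⟩
  have eu (k : ℕ) : (u k ^ ((2 : ℝ) / 3)) ^ ((3 : ℝ) / 2) = u k := by
    rw [← Real.rpow_mul (hu0 k)]; norm_num
  have ev (k : ℕ) : (v k ^ ((1 : ℝ) / 3)) ^ (3 : ℝ) = v k := by
    rw [← Real.rpow_mul (hv0 k)]; norm_num
  have key (k : ℕ) : w k ≤ u k ^ ((2 : ℝ) / 3) * v k ^ ((1 : ℝ) / 3) := by
    have hu' := hu0 k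
    have hv' := hv0 k
    refine le_of_pow_le_pow_left₀ three_ne_zero (by positivity) ((hw k).trans_eq ?_)
    rw [mul_pow, ← Real.rpow_mul_natCast hu', ← Real.rpow_mul_natCast hv']
    norm_num
  have holder := Real.summable_and_inner_le_Lp_mul_Lq_tsum_of_nonneg hpq
    (fun k => Real.rpow_nonneg (hu0 k) (2 / 3)) (fun k => Real.rpow_nonneg (hv0 k) (1 / 3))
    (by simpa only [eu] using hu) (by simpa only [ev] using hv)
  simp only [eu, ev] at holder
  have hws : Summable w := Summable.of_nonneg_of_le hw0 key holder.1
  refine ⟨hws, (hws.tsum_le_tsum key holder.1).trans (holder.2.trans_eq ?_)⟩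
  norm_num

/-- `k ^ 6 ≤ 25 ((k - 2) (k - 1) k) ^ 2 + 65` for every integer `k ≥ 1`, written with `k + 1`. -/
theorem add_one_pow_six_le (k : ℕ) :
    ((k : ℝ) + 1) ^ 6 ≤
      25 * ((((k : ℝ) + 1) - 2) * (((k : ℝ) + 1) - 1) * ((k : ℝ) + 1)) ^ 2 + 65 := by
  rcases k with _ | _ | k
  · norm_num
  · norm_num
  · push_cast
    have hk : (0 : ℝ) ≤ k := k.cast_nonneg
    have h : ((k : ℝ) + 3) ^ 2 ≤ 5 * ((k + 1) * (k + 2)) := by nlinarith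
    have h' : ((k : ℝ) + 3) ^ 3 ≤ 5 * ((k + 1) * (k + 2)) * (k + 3) := by nlinarith
    have h'' := pow_le_pow_left₀ (by positivity) h' 2
    ring_nf at h'' ⊢
    linarith


/-- Lemma 3.2(iii): `‖Sφ‖ ≤ ‖H₀³φ‖^{2/3} ‖φ‖^{1/3} ≤ 5^{2/3} ‖Gφ‖^{2/3} ‖φ‖^{1/3} + 65^{1/3} ‖φ‖`,
expressed via the coefficient sequence `a k = ⟨φ, e k⟩`, where `h = ‖H₀³φ‖`,
`g = ‖Gφ‖` and `f = ‖φ‖`. -/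
theorem coeff_S_le (a : ℕ → ℂ)
    (hg : Summable fun k : ℕ =>
      ((((k : ℝ) + 1) - 2) * (((k : ℝ) + 1) - 1) * ((k : ℝ) + 1)) ^ 2 * ‖a (k + 1)‖ ^ 2)
    (hf : Summable fun k : ℕ => ‖a (k + 1)‖ ^ 2) :
    (Summable fun k : ℕ =>
        (((k : ℝ) + 1) * (((k : ℝ) + 1) - 1)) ^ 2 * ‖a (k + 1)‖ ^ 2) ∧
      Real.sqrt (∑' k : ℕ, (((k : ℝ) + 1) * (((k : ℝ) + 1) - 1)) ^ 2 * ‖a (k + 1)‖ ^ 2) ≤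
        (Real.sqrt (∑' k : ℕ, ((k : ℝ) + 1) ^ 6 * ‖a (k + 1)‖ ^ 2)) ^ ((2 : ℝ) / 3) *
          (Real.sqrt (∑' k : ℕ, ‖a (k + 1)‖ ^ 2)) ^ ((1 : ℝ) / 3) ∧
      Real.sqrt (∑' k : ℕ, (((k : ℝ) + 1) * (((k : ℝ) + 1) - 1)) ^ 2 * ‖a (k + 1)‖ ^ 2) ≤
        (5 : ℝ) ^ ((2 : ℝ) / 3) *
            (Real.sqrt (∑' k : ℕ,
              ((((k : ℝ) + 1) - 2) * (((k : ℝ) + 1) - 1) * ((k : ℝ) + 1)) ^ 2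
                * ‖a (k + 1)‖ ^ 2)) ^ ((2 : ℝ) / 3) *
            (Real.sqrt (∑' k : ℕ, ‖a (k + 1)‖ ^ 2)) ^ ((1 : ℝ) / 3)
          + (65 : ℝ) ^ ((1 : ℝ) / 3) * Real.sqrt (∑' k : ℕ, ‖a (k + 1)‖ ^ 2) := by
  have sqrt_rpow {x : ℝ} (hx : 0 ≤ x) (p : ℝ) : Real.sqrt (x ^ p) = Real.sqrt x ^ p := by
    rw [Real.sqrt_eq_rpow, Real.sqrt_eq_rpow, ← Real.rpow_mul hx, ← Real.rpow_mul hx, mul_comm]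
  have sqrt_rpow_two_thirds {x : ℝ} (hx : 0 ≤ x) : Real.sqrt x ^ ((2 : ℝ) / 3) = x ^ ((1 : ℝ) / 3) := by
    rw [Real.sqrt_eq_rpow, ← Real.rpow_mul hx]; norm_num
  have hbound (k : ℕ) : ((k : ℝ) + 1) ^ 6 * ‖a (k + 1)‖ ^ 2 ≤
      25 * (((((k : ℝ) + 1) - 2) * (((k : ℝ) + 1) - 1) * ((k : ℝ) + 1)) ^ 2
        * ‖a (k + 1)‖ ^ 2) + 65 * ‖a (k + 1)‖ ^ 2 := by
    have := mul_le_mul_of_nonneg_right (add_one_pow_six_le k) (sq_nonneg ‖a (k + 1)‖)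
    linarith
  have hsum := (hg.mul_left 25).add (hf.mul_left 65)
  have hh : Summable fun k : ℕ => ((k : ℝ) + 1) ^ 6 * ‖a (k + 1)‖ ^ 2 :=
    Summable.of_nonneg_of_le (fun k => by positivity) hbound hsum
  have htsum := hh.tsum_le_tsum hbound hsum
  rw [(hg.mul_left 25).tsum_add (hf.mul_left 65), tsum_mul_left, tsum_mul_left] at htsum
  obtain ⟨hs, hle⟩ := summable_and_tsum_le_of_cube_le
    (w := fun k : ℕ => (((k : ℝ) + 1) * (((k : ℝ) + 1) - 1)) ^ 2 * ‖a (k + 1)‖ ^ 2) hh hf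
    (fun k => by positivity) (fun k => by positivity) (fun k => by positivity) (fun k => by
      have hk : (0 : ℝ) ≤ k := k.cast_nonneg
      calc ((((k : ℝ) + 1) * (((k : ℝ) + 1) - 1)) ^ 2 * ‖a (k + 1)‖ ^ 2) ^ 3
          ≤ ((((k : ℝ) + 1) * ((k : ℝ) + 1)) ^ 2 * ‖a (k + 1)‖ ^ 2) ^ 3 := by
            rw [add_sub_cancel_right]
            gcongr
            linarith
        _ = _ := by ring)
  have hH0 : 0 ≤ ∑' k : ℕ, ((k : ℝ) + 1) ^ 6 * ‖a (k + 1)‖ ^ 2 :=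
    tsum_nonneg fun k => by positivity
  have hG0 : 0 ≤ ∑' k : ℕ,
      ((((k : ℝ) + 1) - 2) * (((k : ℝ) + 1) - 1) * ((k : ℝ) + 1)) ^ 2 * ‖a (k + 1)‖ ^ 2 :=
    tsum_nonneg fun k => by positivity
  have hF0 : 0 ≤ ∑' k : ℕ, ‖a (k + 1)‖ ^ 2 := tsum_nonneg fun k => by positivity
  generalize (∑' k : ℕ, ((k : ℝ) + 1) ^ 6 * ‖a (k + 1)‖ ^ 2) = H at *
  generalize (∑' k : ℕ, ((((k : ℝ) + 1) - 2) * (((k : ℝ) + 1) - 1) * ((k : ℝ) + 1)) ^ 2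
    * ‖a (k + 1)‖ ^ 2) = G at *
  generalize (∑' k : ℕ, ‖a (k + 1)‖ ^ 2) = F at *
  have hfirst := Real.sqrt_le_sqrt hle
  rw [Real.sqrt_mul (by positivity), sqrt_rpow hH0, sqrt_rpow hF0] at hfirst
  refine ⟨hs, hfirst, hfirst.trans ?_⟩
  rw [sqrt_rpow_two_thirds hH0, sqrt_rpow_two_thirds hG0]
  have h25 : (25 : ℝ) ^ ((1 : ℝ) / 3) = 5 ^ ((2 : ℝ) / 3) := by
    rw [show (25 : ℝ) = 5 ^ (2 : ℝ) by norm_num, ← Real.rpow_mul (by norm_num)]; norm_num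
  have hsplit : H ^ ((1 : ℝ) / 3) ≤
      5 ^ ((2 : ℝ) / 3) * G ^ ((1 : ℝ) / 3) + 65 ^ ((1 : ℝ) / 3) * F ^ ((1 : ℝ) / 3) := by
    rw [← h25, ← Real.mul_rpow (by norm_num) hG0, ← Real.mul_rpow (by norm_num) hF0]
    exact (Real.rpow_le_rpow hH0 htsum (by norm_num)).trans
      (Real.rpow_add_le_add_rpow (by positivity) (by positivity) (by norm_num) (by norm_num))
  have hFF : F ^ ((1 : ℝ) / 3) * Real.sqrt F ^ ((1 : ℝ) / 3) = Real.sqrt F := by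
    rw [← sqrt_rpow_two_thirds hF0, ← Real.rpow_add_of_nonneg (Real.sqrt_nonneg F) (by norm_num) (by norm_num)]
    norm_num
  calc H ^ ((1 : ℝ) / 3) * Real.sqrt F ^ ((1 : ℝ) / 3)
      ≤ (5 ^ ((2 : ℝ) / 3) * G ^ ((1 : ℝ) / 3) + 65 ^ ((1 : ℝ) / 3) * F ^ ((1 : ℝ) / 3)) *
          Real.sqrt F ^ ((1 : ℝ) / 3) := by gcongr
    _ = _ := by rw [add_mul, mul_assoc (65 ^ _), hFF]
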